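/- If p ≡ 1 (mod 4), then the subgroup H = im θ has index 2 in G. -/

import Mathlib

noncomputable section

/-- `G̃ ⊆ GL₂(F_p) × F_{p²}ˣ`: the subgroup of pairs `(σ, u)` with `det σ = u²`. -/
def Gtilde (p : ℕ) [Fact p.Prime] :
    Subgroup (GL (Fin 2) (ZMod p) × (GaloisField p 2)ˣ) :=
  MonoidHom.eqLocus
    ((Units.map (algebraMap (ZMod p) (GaloisField p 2)).toMonoidHom).comp
      ((Matrix.GeneralLinearGroup.det).comp (MonoidHom.fst _ _)))
    ((powMonoidHom 2).comp (MonoidHom.snd _ _))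

/-- The homomorphism `λ ↦ (λ·I, λ^{(p+1)/2})`. -/
def scalarPair (p : ℕ) [Fact p.Prime] :
    (ZMod p)ˣ →* GL (Fin 2) (ZMod p) × (GaloisField p 2)ˣ :=
  (Units.map (Matrix.scalar (Fin 2)).toMonoidHom).prod
    ((powMonoidHom ((p + 1) / 2)).comp
      (Units.map (algebraMap (ZMod p) (GaloisField p 2)).toMonoidHom))

/-- The central subgroup `N = {(λ·I, λ^{(p+1)/2}) : λ ∈ F_pˣ}` of `G̃`. -/
def Ncen (p : ℕ) [Fact p.Prime] : Subgroup (Gtilde p) :=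
  Subgroup.comap (Gtilde p).subtype (scalarPair p).range

lemma scalarPair_central (p : ℕ) [Fact p.Prime] (lam : (ZMod p)ˣ)
    (h : GL (Fin 2) (ZMod p) × (GaloisField p 2)ˣ) :
    h * scalarPair p lam = scalarPair p lam * h := by
  refine Prod.ext ?_ ?_
  · apply Units.ext
    show (h.1 : Matrix (Fin 2) (Fin 2) (ZMod p)) * Matrix.scalar (Fin 2) (lam : ZMod p) =
      Matrix.scalar (Fin 2) (lam : ZMod p) * (h.1 : Matrix (Fin 2) (Fin 2) (ZMod p))
    exact (Matrix.scalar_commute (lam : ZMod p) (fun r => Commute.all _ r)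
      (h.1 : Matrix (Fin 2) (Fin 2) (ZMod p))).eq.symm
  · exact mul_comm _ _

instance Ncen_normal (p : ℕ) [Fact p.Prime] : (Ncen p).Normal := by
  constructor
  intro n hn g
  rw [Ncen, Subgroup.mem_comap, MonoidHom.mem_range] at hn ⊢
  obtain ⟨lam, hlam⟩ := hn
  refine ⟨lam, ?_⟩
  have : (Gtilde p).subtype (g * n * g⁻¹)
      = (g : GL (Fin 2) (ZMod p) × (GaloisField p 2)ˣ) * (Gtilde p).subtype n * (g : _)⁻¹ := by
    simp [map_mul]
  rw [this, ← hlam, scalarPair_central, mul_assoc]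
  simp

/-- `G = G̃/N`. -/
abbrev Gquot (p : ℕ) [Fact p.Prime] : Type := Gtilde p ⧸ Ncen p

/-- `θ : SL₂(F_p) → G`, sending `σ` to the class of `(σ, 1)`. -/
def theta (p : ℕ) [Fact p.Prime] :
    Matrix.SpecialLinearGroup (Fin 2) (ZMod p) →* Gquot p :=
  (QuotientGroup.mk' (Ncen p)).comp
    (MonoidHom.codRestrict ((Matrix.SpecialLinearGroup.toGL).prod 1) (Gtilde p)
      (by
        intro σ
        show (Units.map (algebraMap (ZMod p) (GaloisField p 2)).toMonoidHom)
            (Matrix.GeneralLinearGroup.det (Matrix.SpecialLinearGroup.toGL σ)) = (1 : (GaloisField p 2)ˣ) ^ 2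
        have hdet : Matrix.GeneralLinearGroup.det (Matrix.SpecialLinearGroup.toGL σ) = 1 := by
          apply Units.ext
          show Matrix.det (σ : Matrix (Fin 2) (Fin 2) (ZMod p)) = 1
          exact σ.prop
        rw [hdet, map_one, one_pow]))

/-- The inclusion `F_pˣ → F_{p²}ˣ`. -/
def incl (p : ℕ) [Fact p.Prime] : (ZMod p)ˣ →* (GaloisField p 2)ˣ :=
  Units.map (algebraMap (ZMod p) (GaloisField p 2)).toMonoidHom

lemma incl_injective (p : ℕ) [Fact p.Prime] : Function.Injective (incl p) := by
  intro a b h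
  apply Units.ext
  apply (algebraMap (ZMod p) (GaloisField p 2)).injective
  exact congrArg Units.val h

lemma mem_Gtilde (p : ℕ) [Fact p.Prime] (g : GL (Fin 2) (ZMod p) × (GaloisField p 2)ˣ) :
    g ∈ Gtilde p ↔ incl p (Matrix.GeneralLinearGroup.det g.1) = g.2 ^ 2 := Iff.rfl

lemma pow_pow_half (p : ℕ) [Fact p.Prime] (hp4 : p % 4 = 1) (c : (ZMod p)ˣ) :
    (c ^ ((p + 1) / 2)) ^ ((p + 1) / 2) = c := by
  obtain ⟨k, hk⟩ : ∃ k, p = 4 * k + 1 := ⟨p / 4, by omega⟩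
  have h1 : (p + 1) / 2 = 2 * k + 1 := by omega
  have h2 : c ^ (4 * k) = 1 := by
    have := ZMod.units_pow_card_sub_one_eq_one p c
    rwa [show p - 1 = 4 * k by omega] at this
  rw [h1, ← pow_mul, show (2 * k + 1) * (2 * k + 1) = 4 * k * (k + 1) + 1 by ring, pow_succ,
    pow_mul, h2, one_pow, one_mul]

lemma scalarPair_mem (p : ℕ) [Fact p.Prime] (hp4 : p % 4 = 1) (c : (ZMod p)ˣ) :
    scalarPair p c ∈ Gtilde p := by
  rw [mem_Gtilde]
  have h1 : (scalarPair p c).2 = incl p (c ^ ((p + 1) / 2)) := by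
    rw [map_pow]; rfl
  have h2 : Matrix.GeneralLinearGroup.det (scalarPair p c).1 = c ^ 2 := by
    apply Units.ext
    show Matrix.det (Matrix.scalar (Fin 2) (c : ZMod p)) = _
    simp [pow_two]
  rw [h1, h2, ← map_pow, ← pow_mul, show (p + 1) / 2 * 2 = (p - 1) + 2 by omega, pow_add,
    ZMod.units_pow_card_sub_one_eq_one, one_mul]

lemma mem_range_theta (p : ℕ) [Fact p.Prime] (hp4 : p % 4 = 1) (g : Gtilde p) :
    (QuotientGroup.mk' (Ncen p) g) ∈ (theta p).range ↔ ∃ c, incl p c = g.1.2 := by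
  constructor
  · rintro ⟨s, hs⟩
    have h := QuotientGroup.eq.mp hs
    obtain ⟨lam, hl⟩ := h
    refine ⟨lam ^ ((p + 1) / 2), ?_⟩
    have h2 := congrArg Prod.snd hl
    have h3 : (1 : (GaloisField p 2)ˣ)⁻¹ * g.1.2 = g.1.2 := by simp
    rw [map_pow, ← h3]
    exact h2
  · rintro ⟨c, hc⟩
    set n : Gtilde p := ⟨scalarPair p (c ^ ((p + 1) / 2)), scalarPair_mem p hp4 _⟩ with hn
    have hn2 : n.1.2 = g.1.2 := by
      have h1 : n.1.2 = incl p ((c ^ ((p + 1) / 2)) ^ ((p + 1) / 2)) := by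
        rw [map_pow]; rfl
      rw [h1, pow_pow_half p hp4, hc]
    have hm : (g * n⁻¹).1.2 = 1 := by
      show g.1.2 * (n.1.2)⁻¹ = 1
      rw [hn2, mul_inv_cancel]
    have hd : Matrix.GeneralLinearGroup.det (g * n⁻¹).1.1 = 1 := by
      apply incl_injective p
      rw [(mem_Gtilde p _).mp (g * n⁻¹).2, hm, one_pow, map_one]
    refine ⟨⟨((g * n⁻¹).1.1 : Matrix (Fin 2) (Fin 2) (ZMod p)), congrArg Units.val hd⟩, ?_⟩
    have hnN : n⁻¹ ∈ Ncen p := inv_mem ⟨_, rfl⟩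
    have hq : QuotientGroup.mk' (Ncen p) g = QuotientGroup.mk' (Ncen p) (g * n⁻¹) := by
      rw [map_mul, (QuotientGroup.eq_one_iff (N := Ncen p) n⁻¹).mpr hnN |> fun h =>
        (show QuotientGroup.mk' (Ncen p) n⁻¹ = 1 from h), mul_one]
    rw [hq]
    apply congrArg (QuotientGroup.mk' (Ncen p))
    apply Subtype.ext
    refine Prod.ext (Units.ext rfl) hm.symm

lemma mul_isSquare_of_not (p : ℕ) [Fact p.Prime] (hp2 : 2 < p) (a b : (ZMod p)ˣ)
    (ha : ¬ IsSquare a) (hb : ¬ IsSquare b) : IsSquare (a * b) := by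
  have hc : ringChar (ZMod p) ≠ 2 := by rw [ZMod.ringChar_zmod_n]; omega
  rw [FiniteField.unit_isSquare_iff hc] at *
  have h := fun c : (ZMod p)ˣ => FiniteField.pow_dichotomy hc c.ne_zero
  rw [Units.ext_iff] at *
  push_cast at *
  rw [mul_pow, (h a).resolve_left ha, (h b).resolve_left hb]
  norm_num

lemma exists_sqrt (p : ℕ) [Fact p.Prime] (hp2 : 2 < p) (d : (ZMod p)ˣ) :
    ∃ a : (GaloisField p 2)ˣ, incl p d = a ^ 2 := by
  have : Fintype (GaloisField p 2) := Fintype.ofFinite _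
  have hcard : Fintype.card (GaloisField p 2) = p ^ 2 := by
    rw [← Nat.card_eq_fintype_card, GaloisField.card p 2 two_ne_zero]
  have hc : ringChar (GaloisField p 2) ≠ 2 := by
    have h := ringChar.eq (GaloisField p 2) p
    omega
  have hodd : p % 2 = 1 := (Fact.out : p.Prime).eq_two_or_odd.resolve_left (by omega)
  have hs : IsSquare (incl p d) := by
    rw [FiniteField.unit_isSquare_iff hc, hcard]
    obtain ⟨k, rfl⟩ : ∃ k, p = 2 * k + 1 := ⟨p / 2, by omega⟩
    have h2 : (2 * k + 1) ^ 2 / 2 = (2 * k + 1 - 1) * (k + 1) := by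
      rw [show (2 * k + 1) ^ 2 = 2 * (2 * k * (k + 1)) + 1 by ring, Nat.add_sub_cancel]
      omega
    rw [h2, ← map_pow, pow_mul, ZMod.units_pow_card_sub_one_eq_one, one_pow, map_one]
  obtain ⟨a, ha⟩ := hs
  exact ⟨a, by rw [ha, pow_two]⟩

/-- If `p ≡ 1 (mod 4)`, then the subgroup `H = im θ` has index `2`
in `G`. -/
theorem stmt_6 (p : ℕ) [Fact p.Prime] (hp2 : 2 < p) (hp4 : p % 4 = 1) :
    (theta p).range.index = 2 := by
  have hc : ringChar (ZMod p) ≠ 2 := by rw [ZMod.ringChar_zmod_n]; omega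
  obtain ⟨d0, hd0⟩ := FiniteField.exists_nonsquare hc
  have hd0' : d0 ≠ 0 := by rintro rfl; exact hd0 (IsSquare.zero)
  obtain ⟨d, rfl⟩ : ∃ d : (ZMod p)ˣ, (d : ZMod p) = d0 := ⟨Units.mk0 d0 hd0', rfl⟩
  have hd : ¬ IsSquare d := fun ⟨r, hr⟩ => hd0 ⟨r, by rw [hr]; rfl⟩
  obtain ⟨α, hα⟩ := exists_sqrt p hp2 d
  have hα' : ∀ c, incl p c ≠ α := by
    intro c h
    rw [← h, ← map_pow] at hα
    exact hd ⟨c, by rw [← pow_two]; exact incl_injective p hα⟩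
  let σ : GL (Fin 2) (ZMod p) :=
    Matrix.GeneralLinearGroup.mkOfDetNeZero !![(d : ZMod p), 0; 0, 1] (by simp)
  have hσ : Matrix.GeneralLinearGroup.det σ = d := by
    apply Units.ext
    show Matrix.det !![(d : ZMod p), 0; 0, 1] = d
    simp
  have hmem : (σ, α) ∈ Gtilde p := by
    rw [mem_Gtilde]
    show incl p (Matrix.GeneralLinearGroup.det σ) = α ^ 2
    rw [hσ, hα]
  rw [Subgroup.index_eq_two_iff_exists_notMem_and]
  refine ⟨QuotientGroup.mk' (Ncen p) ⟨(σ, α), hmem⟩, ?_, ?_⟩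
  · rw [mem_range_theta p hp4]
    rintro ⟨c, h⟩
    exact hα' c h
  · intro b
    obtain ⟨b, rfl⟩ := QuotientGroup.mk'_surjective (Ncen p) b
    rw [← map_mul, mem_range_theta p hp4, mem_range_theta p hp4]
    have key : ∀ u : (GaloisField p 2)ˣ, ∀ f : (ZMod p)ˣ, IsSquare f → incl p f = u ^ 2 →
        ∃ c, incl p c = u := by
      rintro u f ⟨r, rfl⟩ h
      rw [← pow_two, map_pow, Units.ext_iff] at h
      push_cast at h
      rcases sq_eq_sq_iff_eq_or_eq_neg.mp h with h | h
      · exact ⟨r, Units.ext h⟩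
      · refine ⟨-r, Units.ext ?_⟩
        have h' : ((incl p (-r) : (GaloisField p 2)ˣ) : GaloisField p 2) = -(incl p r) := by
          show algebraMap (ZMod p) (GaloisField p 2) ((-r : (ZMod p)ˣ) : ZMod p) =
            - algebraMap (ZMod p) (GaloisField p 2) (r : ZMod p)
          rw [Units.val_neg, map_neg]
        rw [h', h, neg_neg]
    have hb := (mem_Gtilde p _).mp b.2
    by_cases he : IsSquare (Matrix.GeneralLinearGroup.det b.1.1)
    · exact Or.inr (key _ _ he hb)
    · left
      refine key (b.1.2 * α) _ (mul_isSquare_of_not p hp2 _ _ he hd) ?_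
      rw [map_mul, hb, hα, mul_pow]
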